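/- Any module element g = (g_1,…,g_N) ∈ R^N with ν(g) ≠ 0 can be carried to a clean module element: there exists a clean g' ∈ R^N such that ν(g') = ν(g). -/

import Mathlib

open MvPolynomial

noncomputable section

namespace TropF5

/-- Variable index type: `none` is the homogenizing variable `h`,
`some (.inl i)` is `x i`, `some (.inr i)` is `∂ i` (resp. `ξ i`). -/
abbrev Vars (n : ℕ) := Option (Fin n ⊕ Fin n)

/-- The commutative polynomial ring `K[h, x, ξ]`. -/
abbrev Poly (n : ℕ) (K : Type*) [Field K] := MvPolynomial (Vars n) K

/-- Monomials (exponent vectors) of `K[h,x,ξ]`. -/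
abbrev Mon (n : ℕ) := Vars n →₀ ℕ

/-- Module monomials `h^γ x^α ξ^β e_i` of `K[h,x,ξ]^N`. -/
abbrev MMon (n N : ℕ) := Mon n × Fin N

/-- Total degree of a monomial. -/
def mdeg {n : ℕ} (d : Mon n) : ℕ := d.sum fun _ k => k

/-- The weight `w·(α,β)` of the `(x,ξ)`-part of a monomial. -/
def wdeg {n : ℕ} (w : Fin n ⊕ Fin n → ℝ) (d : Mon n) : ℝ :=
  ∑ j : Fin n ⊕ Fin n, w j * (d (some j) : ℝ)

/-- The `(x,ξ)`-part `x^α ξ^β` of a monomial `h^γ x^α ξ^β`. -/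
def xiPart {n : ℕ} (d : Mon n) : (Fin n ⊕ Fin n) →₀ ℕ :=
  Finsupp.equivFunOnFinite.symm fun j => d (some j)

/-- The data defining a tropical term order on `K[h,x,ξ]`: a valuation on `K`,
weight vectors `w, ω ∈ ℝ^{2n}`, and a monomial order `prec` used as tie-breaker. -/
structure OrdData (n : ℕ) (K : Type*) [Field K] where
  val : K → ℝ
  val_mul : ∀ a b : K, a ≠ 0 → b ≠ 0 → val (a * b) = val a + val b
  val_add : ∀ a b : K, a ≠ 0 → b ≠ 0 → a + b ≠ 0 → min (val a) (val b) ≤ val (a + b)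
  w : Fin n ⊕ Fin n → ℝ
  om : Fin n ⊕ Fin n → ℝ
  w_nonneg : ∀ i : Fin n, 0 ≤ w (Sum.inl i)
  w_big : ∀ i j : Fin n, w (Sum.inl j) < w (Sum.inr i)
  prec : LinearOrder ((Fin n ⊕ Fin n) →₀ ℕ)
  prec_add : ∀ u v t : (Fin n ⊕ Fin n) →₀ ℕ, prec.lt u v → prec.lt (u + t) (v + t)
  prec_zero_le : ∀ u, prec.le 0 u

variable {n N : ℕ} {K : Type*} [Field K]

/-- The strict tropical term order `<_h` on terms `a·d`, `b·e` of `K[h,x,ξ]`: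
first by total degree, then by `w`-weight, then by valuation-adjusted `ω`-weight,
and finally by the tie-breaking monomial order on the `(x,ξ)`-parts. -/
def ltTerm (D : OrdData n K) (a : K) (d : Mon n) (b : K) (e : Mon n) : Prop :=
  mdeg d < mdeg e ∨ (mdeg d = mdeg e ∧
    (wdeg D.w d < wdeg D.w e ∨ (wdeg D.w d = wdeg D.w e ∧
      (-D.val a + wdeg D.om d < -D.val b + wdeg D.om e ∨
        (-D.val a + wdeg D.om d = -D.val b + wdeg D.om e ∧
          D.prec.lt (xiPart d) (xiPart e))))))

/-- `d` is the `≤_h`-leading monomial of the polynomial `p`. -/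
def IsLM (D : OrdData n K) (p : Poly n K) (d : Mon n) : Prop :=
  d ∈ p.support ∧ ∀ e ∈ p.support, e ≠ d → ltTerm D (p.coeff e) e (p.coeff d) d

open Classical in
/-- The `≤_h`-leading monomial of a polynomial (junk value `0` if there is none). -/
def LM (D : OrdData n K) (p : Poly n K) : Mon n :=
  if h : ∃ d, IsLM D p d then h.choose else 0

/-- The module element `σ e_i` of `K[h,x,ξ]^N` corresponding to a module monomial. -/
def msingle {N : ℕ} (m : MMon n N) : Fin N → Poly n K := Pi.single m.2 (monomial m.1 1)

/-- Product of a monomial with a module monomial. -/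
def mulM {N : ℕ} (d : Mon n) (m : MMon n N) : MMon n N := (d + m.1, m.2)

/-- An abstract setting for the homogenized Weyl algebra `R = D_n^{(h)}(K)`:
a `K`-algebra `R` with generators `h, x_i, ∂_i` satisfying the Weyl relations,
the total-symbol `K`-linear isomorphism `Ψ_h : R ≃ K[h,x,ξ]` sending normally
ordered monomials to monomials, a tropical order datum, and a generating family
`F` of homogeneous elements. -/
structure Setting (n N : ℕ) (K : Type*) [Field K] (R : Type*) [Ring R] [Algebra K R] where
  D : OrdData n K
  /-- the generators: `Xg none = h`, `Xg (some (.inl i)) = x i`, `Xg (some (.inr i)) = ∂ i` -/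
  Xg : Vars n → R
  h_comm : ∀ v, Xg none * Xg v = Xg v * Xg none
  x_comm : ∀ i j : Fin n,
    Xg (some (Sum.inl i)) * Xg (some (Sum.inl j)) = Xg (some (Sum.inl j)) * Xg (some (Sum.inl i))
  d_comm : ∀ i j : Fin n,
    Xg (some (Sum.inr i)) * Xg (some (Sum.inr j)) = Xg (some (Sum.inr j)) * Xg (some (Sum.inr i))
  dx_comm : ∀ i j : Fin n, i ≠ j →
    Xg (some (Sum.inr i)) * Xg (some (Sum.inl j)) = Xg (some (Sum.inl j)) * Xg (some (Sum.inr i))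
  dx_h : ∀ i : Fin n,
    Xg (some (Sum.inr i)) * Xg (some (Sum.inl i))
      = Xg (some (Sum.inl i)) * Xg (some (Sum.inr i)) + Xg none ^ 2
  /-- the total symbol map `Ψ_h` -/
  Psi : R ≃ₗ[K] Poly n K
  Psi_monomial : ∀ d : Mon n,
    Psi (Xg none ^ d none *
      ((List.ofFn fun i : Fin n => Xg (some (Sum.inl i)) ^ d (some (Sum.inl i))).prod *
       (List.ofFn fun i : Fin n => Xg (some (Sum.inr i)) ^ d (some (Sum.inr i))).prod)) =
    monomial d 1
  /-- the generating set `F = {f_1, …, f_N}` -/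
  F : Fin N → R
  F_hom : ∀ i, ∃ dF : ℕ, (Psi (F i)).IsHomogeneous dF

namespace Setting

variable {R : Type*} [Ring R] [Algebra K R] [NeZero N] (S : Setting n N K R)

/-- `ν : R^N → I`, `ν(a) = Σ a_i f_i`. -/
def nu (g : Fin N → R) : R := ∑ i, g i * S.F i

/-- The left ideal `I` generated by `F`. -/
def idl : Submodule R R := Submodule.span R (Set.range S.F)

/-- The componentwise total symbol map `Φ : R^N → K[h,x,ξ]^N`. -/
def Phi (g : Fin N → R) : Fin N → Poly n K := fun i => S.Psi (g i)

/-- The inverse total symbol of a monomial: the monomial `h^γ x^α ∂^β` of `R`. -/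
def monR (d : Mon n) : R := S.Psi.symm (monomial d 1)

/-- `t` is a term (nonzero coefficient times a monomial) of `R`. -/
def IsTermR (t : R) : Prop := ∃ (d : Mon n) (c : K), c ≠ 0 ∧ S.Psi t = monomial d c

/-- `≤_h`-leading monomial of an element of `R` (via its total symbol). -/
def LMr (f : R) : Mon n := LM S.D (S.Psi f)

/-- `≤_h`-leading coefficient of an element of `R`. -/
def LCr (f : R) : K := (S.Psi f).coeff (S.LMr f)

/-- `LT_h f ≤_h LT_h g` (strictly smaller, or equal monomials and equal valuations). -/
def leLT (f g : R) : Prop :=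
  ltTerm S.D (S.LCr f) (S.LMr f) (S.LCr g) (S.LMr g) ∨
    (S.D.val (S.LCr f) = S.D.val (S.LCr g) ∧ S.LMr f = S.LMr g)


/-- `m` is the leading monomial of the syzygy `a`: writing `m = (d, i)`,
`i` is the largest index with `a i ≠ 0` and `d = LM_h (a i)`. -/
def IsSyzLM (m : MMon n N) : Prop :=
  ∃ a : Fin N → R, S.nu a = 0 ∧ a m.2 ≠ 0 ∧ (∀ j, m.2 < j → a j = 0) ∧
    IsLM S.D (S.Psi (a m.2)) m.1

/-- `LSyz(F)`: the `K[h,x,ξ]`-submodule generated by leading monomials of syzygies. -/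
def LSyz : Submodule (Poly n K) (Fin N → Poly n K) :=
  Submodule.span _ { v | ∃ m : MMon n N, S.IsSyzLM m ∧ v = msingle m }

/-- Membership of a module monomial in `LSyz(F)`. -/
def inLSyz (m : MMon n N) : Prop := msingle m ∈ S.LSyz

/-- The strict total order `<_sign` on module monomials. -/
def ltSign (m m' : MMon n N) : Prop :=
  m.2 < m'.2 ∨ (m.2 = m'.2 ∧ (mdeg m.1 < mdeg m'.1 ∨ (mdeg m.1 = mdeg m'.1 ∧
    (wdeg S.D.w m.1 < wdeg S.D.w m'.1 ∨ (wdeg S.D.w m.1 = wdeg S.D.w m'.1 ∧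
      ((¬ S.inLSyz m ∧ S.inLSyz m') ∨
        ((S.inLSyz m ↔ S.inLSyz m') ∧ S.D.prec.lt (xiPart m.1) (xiPart m'.1))))))))

/-- `m` is the `≤_sign`-largest module monomial of `Φ(g)`. -/
def IsLMsign (g : Fin N → R) (m : MMon n N) : Prop :=
  m.1 ∈ (S.Psi (g m.2)).support ∧
    ∀ m' : MMon n N, m'.1 ∈ (S.Psi (g m'.2)).support → m' ≠ m → S.ltSign m' m

open Classical in
/-- `LM_sign(g)` (junk value if there is none). -/
def LMsign (g : Fin N → R) : MMon n N :=
  if h : ∃ m, S.IsLMsign g m then h.choose else ((0 : Mon n), (0 : Fin N))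

/-- `m` is the signature of `f`: the `≤_sign`-minimum of
`{LM_sign(g) : ν(g) = f}`. -/
def IsSig (f : R) (m : MMon n N) : Prop :=
  (∃ g : Fin N → R, S.nu g = f ∧ S.IsLMsign g m) ∧
    ∀ (g : Fin N → R) (m' : MMon n N), S.nu g = f → S.IsLMsign g m' → ¬ S.ltSign m' m

open Classical in
/-- The signature `s(f)` of `f ∈ I \ {0}` (junk value if there is none). -/
def sig (f : R) : MMon n N :=
  if h : ∃ m, S.IsSig f m then h.choose else ((0 : Mon n), (0 : Fin N))


/-- A module element is clean if `ν(g) ≠ 0` and no module monomial of `Φ(g)`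
belongs to `LSyz(F)`. -/
def Clean (g : Fin N → R) : Prop :=
  S.nu g ≠ 0 ∧ ∀ m : MMon n N, m.1 ∈ (S.Psi (g m.2)).support → ¬ S.inLSyz m

/-- `f` is `s`-top-reducible with respect to the module monomial `m`:
some `g ∈ I \ {0}` and term `t` satisfy `LM_h(t g) = LM_h(f)` and `s(t g) <_sign m`. -/
def sTopRed (f : R) (m : MMon n N) : Prop :=
  ∃ g ∈ S.idl, g ≠ 0 ∧ ∃ t : R, S.IsTermR t ∧
    S.LMr (t * g) = S.LMr f ∧ S.ltSign (S.sig (t * g)) m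

/-- `f` is `s`-top-irreducible with respect to `m`. -/
def sTopIrr (f : R) (m : MMon n N) : Prop := f = 0 ∨ ¬ S.sTopRed f m

/-- `σ` is the value `Ω(m)`: the `≤_sign`-minimum of
`{s(f) : f ∈ I \ {0}, LM_h(f) = m}`. -/
def IsOmega (m : Mon n) (σ : MMon n N) : Prop :=
  (∃ f, f ∈ S.idl ∧ f ≠ 0 ∧ S.LMr f = m ∧ S.sig f = σ) ∧
    ∀ f, f ∈ S.idl → f ≠ 0 → S.LMr f = m → ¬ S.ltSign (S.sig f) σ

open Classical in
/-- The map `Ω` (junk value if the minimum does not exist). -/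
def Omega (m : Mon n) : MMon n N :=
  if h : ∃ σ, S.IsOmega m σ then h.choose else ((0 : Mon n), (0 : Fin N))

/-- `G` is an `s`-Gröbner basis of `I`. -/
def IsSGB (G : Set R) : Prop :=
  G.Nonempty ∧ Submodule.span R G = S.idl ∧
    ∀ f ∈ S.idl, f ≠ 0 → S.sTopIrr f (S.sig f) →
      ∃ g ∈ G, ∃ d : Mon n,
        S.LMr (S.monR d * g) = S.LMr f ∧ mulM d (S.sig g) = S.sig f

/-- `G` is a (tropical) Gröbner basis of `I`:
`RG = I` and `⟨LM_h(G)⟩ = ⟨LM_h(I)⟩`. -/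
def IsGB (G : Set R) : Prop :=
  G.Nonempty ∧ Submodule.span R G = S.idl ∧
    Ideal.span ((fun g => (monomial (S.LMr g) 1 : Poly n K)) '' {g | g ∈ G ∧ g ≠ 0}) =
      Ideal.span ((fun g => (monomial (S.LMr g) 1 : Poly n K)) '' {f | f ∈ S.idl ∧ f ≠ 0})

/-- `g` is primitive `s`-top-irreducible. -/
def Primitive (g : R) : Prop :=
  g ∈ S.idl ∧ g ≠ 0 ∧ S.sTopIrr g (S.sig g) ∧
    ¬ ∃ g', g' ∈ S.idl ∧ g' ≠ 0 ∧ S.sTopIrr g' (S.sig g') ∧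
      ∃ d : Mon n, d ≠ 0 ∧ S.LMr (S.monR d * g') = S.LMr g ∧
        S.sig (S.monR d * g') = S.sig g

/-- `f` is redundant to `G`. -/
def Redundant (f : R) (G : Set R) : Prop :=
  f ≠ 0 ∧ ∃ g ∈ G, ∃ (d : Mon n) (c : K), c ≠ 0 ∧
    f = S.Psi.symm (monomial d c) * g ∧ S.ltSign (S.sig f) (mulM d (S.sig g))

/-- The cofactor `u_1` of the S-pair of `(g_1, g_2)`. -/
def u1 (g1 g2 : R) : R :=
  S.Psi.symm (monomial ((S.LMr g1 ⊔ S.LMr g2) - S.LMr g1) (S.LCr g2))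

/-- The cofactor `u_2` of the S-pair of `(g_1, g_2)`. -/
def u2 (g1 g2 : R) : R :=
  S.Psi.symm (monomial ((S.LMr g1 ⊔ S.LMr g2) - S.LMr g2) (S.LCr g1))

/-- The S-pair `spair(g_1, g_2) = u_1 g_1 - u_2 g_2`. -/
def spair (g1 g2 : R) : R := S.u1 g1 g2 * g1 - S.u2 g1 g2 * g2

/-- `(g_1, g_2)` is a normal pair relative to `G`. -/
def NormalPair (G : Set R) (g1 g2 : R) : Prop :=
  S.Primitive g1 ∧ S.Primitive g2 ∧
    S.sig (S.u1 g1 g2 * g1) = mulM ((S.LMr g1 ⊔ S.LMr g2) - S.LMr g1) (S.sig g1) ∧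
    S.sig (S.u2 g1 g2 * g2) = mulM ((S.LMr g1 ⊔ S.LMr g2) - S.LMr g2) (S.sig g2) ∧
    S.sig (S.u1 g1 g2 * g1) ≠ S.sig (S.u2 g1 g2 * g2) ∧
    ¬ S.Redundant (S.spair g1 g2) G

end Setting

end TropF5

namespace TropF5

section Order

variable {n : ℕ} {K : Type*} [Field K]

/-- The exponent vectors of `x^α ξ^β`, ordered by the tie-breaking order of `D`. -/
def PrecMon (_ : OrdData n K) : Type := (Fin n ⊕ Fin n) →₀ ℕ

instance (D : OrdData n K) : LinearOrder (PrecMon D) := D.prec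

/-- A key in a lexicographic product that encodes `ltTerm`. -/
def termKey (D : OrdData n K) (a : K) (d : Mon n) : ℕ ×ₗ ℝ ×ₗ ℝ ×ₗ PrecMon D :=
  toLex (mdeg d, toLex (wdeg D.w d, toLex (-D.val a + wdeg D.om d, (xiPart d : PrecMon D))))

lemma ltTerm_iff_termKey (D : OrdData n K) (a : K) (d : Mon n) (b : K) (e : Mon n) :
    ltTerm D a d b e ↔ termKey D a d < termKey D b e := by
  simp only [termKey, Prod.Lex.toLex_lt_toLex]
  rfl

lemma mdeg_eq (d : Mon n) : mdeg d = d none + ∑ j, d (some j) := by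
  rw [mdeg, Finsupp.sum_fintype _ _ (fun _ => rfl), Fintype.sum_option]

lemma mdeg_add (d e : Mon n) : mdeg (d + e) = mdeg d + mdeg e := by
  simp only [mdeg_eq, Finsupp.add_apply, Finset.sum_add_distrib]
  ring

lemma wdeg_add (w : Fin n ⊕ Fin n → ℝ) (d e : Mon n) :
    wdeg w (d + e) = wdeg w d + wdeg w e := by
  simp [wdeg, mul_add, Finset.sum_add_distrib]

lemma xiPart_add (d e : Mon n) : xiPart (d + e) = xiPart d + xiPart e := by
  ext j
  simp [xiPart]

lemma ltTerm_add_left (D : OrdData n K) (c : Mon n) {a b : K} {d e : Mon n}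
    (h : ltTerm D a d b e) : ltTerm D a (c + d) b (c + e) := by
  simp only [ltTerm, mdeg_add, wdeg_add, xiPart_add] at h ⊢
  rcases h with h | ⟨h1, h | ⟨h2, h | ⟨h3, h⟩⟩⟩
  · exact Or.inl (by omega)
  · exact Or.inr ⟨by omega, Or.inl (by linarith)⟩
  · exact Or.inr ⟨by omega, Or.inr ⟨by linarith, Or.inl (by linarith)⟩⟩
  · refine Or.inr ⟨by omega, Or.inr ⟨by linarith, Or.inr ⟨by linarith, ?_⟩⟩⟩
    rw [add_comm (xiPart c), add_comm (xiPart c)]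
    exact D.prec_add _ _ _ h

lemma ltTerm_mul_left (D : OrdData n K) {c a b : K} {d e : Mon n} (hc : c ≠ 0) (ha : a ≠ 0)
    (hb : b ≠ 0) (h : ltTerm D a d b e) : ltTerm D (c * a) d (c * b) e := by
  simp only [ltTerm, D.val_mul c _ hc ha, D.val_mul c _ hc hb] at h ⊢
  rcases h with h | ⟨h1, h | ⟨h2, h | ⟨h3, h⟩⟩⟩
  · exact Or.inl h
  · exact Or.inr ⟨h1, Or.inl h⟩
  · exact Or.inr ⟨h1, Or.inr ⟨h2, Or.inl (by linarith)⟩⟩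
  · exact Or.inr ⟨h1, Or.inr ⟨h2, Or.inr ⟨by linarith, h⟩⟩⟩

lemma val_lt_of_ltTerm_self (D : OrdData n K) {a b : K} {d : Mon n} (h : ltTerm D a d b d) :
    D.val b < D.val a := by
  rcases h with h | ⟨-, h | ⟨-, h | ⟨-, h⟩⟩⟩
  · exact absurd h (lt_irrefl _)
  · exact absurd h (lt_irrefl _)
  · linarith
  · exact absurd h (lt_irrefl (α := PrecMon D) _)

lemma OrdData.val_neg (D : OrdData n K) {a : K} (ha : a ≠ 0) : D.val (-a) = D.val a := by
  have h1 := D.val_mul 1 1 one_ne_zero one_ne_zero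
  have h2 := D.val_mul (-1) (-1) (by simp) (by simp)
  have h3 := D.val_mul (-1) a (by simp) ha
  simp only [mul_one, neg_mul, one_mul, neg_neg] at h1 h2 h3
  linarith

lemma OrdData.lt_val_sum (D : OrdData n K) {ι : Type*} (s : Finset ι) (f : ι → K) (r : ℝ)
    (h : ∀ i ∈ s, f i ≠ 0 → r < D.val (f i)) (hs : ∑ i ∈ s, f i ≠ 0) :
    r < D.val (∑ i ∈ s, f i) := by
  classical
  induction s using Finset.induction_on with
  | empty => simp at hs
  | insert i s hi ih =>
    rw [Finset.sum_insert hi] at hs ⊢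
    have hs' := fun hne => ih (fun j hj => h j (Finset.mem_insert_of_mem hj)) hne
    have hi' := h i (Finset.mem_insert_self i s)
    by_cases h1 : f i = 0
    · simp only [h1, zero_add] at hs ⊢
      exact hs' hs
    by_cases h2 : ∑ j ∈ s, f j = 0
    · simp only [h2, add_zero] at hs ⊢
      exact hi' hs
    · exact (lt_min (hi' h1) (hs' h2)).trans_le (D.val_add _ _ h1 h2 hs)

lemma IsLM.mdeg_le {D : OrdData n K} {p : Poly n K} {d e : Mon n} (h : IsLM D p d)
    (he : e ∈ p.support) : mdeg e ≤ mdeg d := by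
  by_cases hed : e = d
  · rw [hed]
  · rcases h.2 e he hed with h | ⟨h, -⟩ <;> omega

/-- Polynomials with prescribed pairwise distinct leading monomials can be combined so as to have
arbitrary prescribed coefficients at these monomials. -/
lemma exists_sum_coeff_eq (D : OrdData n K) (L : Finset (Mon n)) (v : L → Poly n K)
    (hv : ∀ m : L, IsLM D (v m) m) (t : L → K) :
    ∃ c : L → K, ∀ m : L, ∑ m' : L, c m' * (v m').coeff m = t m := by
  classical
  let A : Matrix L L K := fun m m' => (v m').coeff m
  have hA : ∀ c m, A.mulVecLin c m = ∑ m' : L, c m' * (v m').coeff m := fun c m =>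
    Finset.sum_congr rfl fun _ _ => mul_comm _ _
  have hinj : Function.Injective A.mulVecLin := by
    rw [← LinearMap.ker_eq_bot, LinearMap.ker_eq_bot']
    intro c hc
    by_contra hne
    obtain ⟨m₀, hm₀⟩ := Function.ne_iff.mp hne
    obtain ⟨m, hm, hmax⟩ := Finset.exists_max_image (Finset.univ.filter fun m => c m ≠ 0)
      (fun m => termKey D (c m * (v m).coeff m) m) ⟨m₀, by simpa using hm₀⟩
    simp only [Finset.mem_filter, Finset.mem_univ, true_and] at hm hmax
    have hlead : (v m).coeff m ≠ 0 := mem_support_iff.mp (hv m).1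
    have hprod : c m * (v m).coeff m ≠ 0 := mul_ne_zero hm hlead
    have hsum : ∑ m' : L, c m' * (v m').coeff m = 0 := by
      rw [← hA, hc, Pi.zero_apply]
    rw [← Finset.add_sum_erase _ _ (Finset.mem_univ m)] at hsum
    have hrest : ∑ m' ∈ Finset.univ.erase m, c m' * (v m').coeff m
        = -(c m * (v m).coeff m) := by
      linear_combination hsum
    have hval : D.val (c m * (v m).coeff m)
        < D.val (∑ m' ∈ Finset.univ.erase m, c m' * (v m').coeff m) := by
      refine D.lt_val_sum _ _ _ (fun m' hm' hne' => ?_) (by rw [hrest]; exact neg_ne_zero.mpr hprod)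
      have hcm' := left_ne_zero_of_mul hne'
      have hco := right_ne_zero_of_mul hne'
      have hmm' : m ≠ m' := (Finset.ne_of_mem_erase hm').symm
      have hlt : ltTerm D (c m' * (v m').coeff m) m (c m' * (v m').coeff m') m' :=
        ltTerm_mul_left D hcm' hco (mem_support_iff.mp (hv m').1)
          ((hv m').2 m (mem_support_iff.mpr hco) (fun h => hmm' (Subtype.ext h)))
      exact val_lt_of_ltTerm_self D ((ltTerm_iff_termKey ..).mpr
        (((ltTerm_iff_termKey ..).mp hlt).trans_le (hmax m' hcm')))
    rw [hrest, D.val_neg hprod] at hval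
    exact lt_irrefl _ hval
  obtain ⟨c, hc⟩ := (LinearMap.injective_iff_surjective.mp hinj) t
  exact ⟨c, fun m => by rw [← hA, hc]⟩

/-- Multiplying by a variable and adding terms of smaller degree or smaller `w`-weight multiplies
the leading monomial by that variable. -/
lemma IsLM.X_mul_add {D : OrdData n K} {p r : Poly n K} {d : Mon n} (h : IsLM D p d) (u : Vars n)
    (hr : ∀ e ∈ r.support, mdeg e < mdeg (Finsupp.single u 1 + d) ∨
      mdeg e = mdeg (Finsupp.single u 1 + d) ∧
        wdeg D.w e < wdeg D.w (Finsupp.single u 1 + d)) :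
    IsLM D (X u * p + r) (Finsupp.single u 1 + d) := by
  have hr0 : r.coeff (Finsupp.single u 1 + d) = 0 := by
    by_contra hne
    rcases hr _ (mem_support_iff.mpr hne) with h | ⟨-, h⟩ <;> exact lt_irrefl _ h
  have hlead : (X u * p + r).coeff (Finsupp.single u 1 + d) = p.coeff d := by
    rw [coeff_add, hr0, add_zero, coeff_X_mul]
  refine ⟨by rw [mem_support_iff, hlead]; exact mem_support_iff.mp h.1, fun e he hne => ?_⟩
  by_cases her : e ∈ r.support
  · rcases hr e her with h | ⟨h1, h2⟩
    · exact Or.inl h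
    · exact Or.inr ⟨h1, Or.inl h2⟩
  have her0 : r.coeff e = 0 := notMem_support_iff.mp her
  have hXp : e ∈ (X u * p).support := by
    rw [mem_support_iff, coeff_add, her0, add_zero] at he
    exact mem_support_iff.mpr he
  rw [support_X_mul] at hXp
  obtain ⟨e', he', rfl⟩ := Finset.mem_map.mp hXp
  simp only [addLeftEmbedding_apply] at her0 hne ⊢
  rw [hlead, coeff_add, her0, add_zero, coeff_X_mul]
  exact ltTerm_add_left D _ (h.2 e' he' (fun hed => hne (by rw [hed])))

lemma finite_setOf_mdeg_le (k : ℕ) : {d : Mon n | mdeg d ≤ k}.Finite := by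
  refine (Set.finite_Iic (Finsupp.equivFunOnFinite.symm fun _ => k : Mon n)).subset fun d hd => ?_
  intro v
  rw [Set.mem_ofPred_eq, mdeg, Finsupp.sum_fintype _ _ (fun _ => rfl)] at hd
  exact (Finset.single_le_sum (f := fun v => d v) (fun _ _ => Nat.zero_le _)
    (Finset.mem_univ v)).trans hd

end Order

section NormalOrdering

variable {R : Type*} [Ring R]

lemma mul_prod_ofFn_pow {n : ℕ} (f : Fin n → R) (hf : ∀ i j, f i * f j = f j * f i)
    (a b : Fin n → ℕ) (i : Fin n) (hi : b i = a i + 1) (hj : ∀ j, j ≠ i → b j = a j) :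
    f i * (List.ofFn fun j => f j ^ a j).prod = (List.ofFn fun j => f j ^ b j).prod := by
  induction n with
  | zero => exact i.elim0
  | succ n ih =>
    simp only [List.ofFn_succ, List.prod_cons]
    cases i using Fin.cases with
    | zero =>
      rw [hi, pow_succ', mul_assoc]
      simp only [fun j : Fin n => hj j.succ (Fin.succ_ne_zero j)]
    | succ i =>
      rw [← ih (fun j => f j.succ) (fun _ _ => hf _ _) (fun j => a j.succ) (fun j => b j.succ) i hi
        (fun j hji => hj _ (fun h => hji (Fin.succ_injective _ h))),
        hj 0 (Fin.succ_ne_zero i).symm, ← mul_assoc, ← mul_assoc,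
        ((show Commute (f i.succ) (f 0) from hf _ _).pow_right _).eq]

lemma mul_pow_of_mul_eq {y f z : R} (h : y * f = f * y + z) (hz : z * f = f * z) (k : ℕ) :
    y * f ^ k = f ^ k * y + k * (z * f ^ (k - 1)) := by
  induction k with
  | zero => simp
  | succ k ih =>
    rw [pow_succ, ← mul_assoc, ih, add_mul, mul_assoc (f ^ k), h]
    have hc : z * f ^ k = f ^ k * z := ((show Commute z f from hz).pow_right k).eq
    cases k with
    | zero => simp
    | succ k =>
      simp only [Nat.add_sub_cancel, mul_assoc, ← pow_succ] at hc ⊢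
      rw [mul_add, ← hc]
      push_cast
      noncomm_ring

lemma commute_prod_ofFn_pow {n : ℕ} {y : R} (f : Fin n → R) (h : ∀ j, y * f j = f j * y)
    (a : Fin n → ℕ) : Commute y (List.ofFn fun j => f j ^ a j).prod := by
  refine Commute.list_prod_right _ _ fun x hx => ?_
  obtain ⟨j, rfl⟩ := List.mem_ofFn.mp hx
  exact (show Commute y (f j) from h j).pow_right _

lemma mul_prod_ofFn_pow_of_mul_eq {n : ℕ} {y z : R} (f : Fin n → R) (i : Fin n)
    (h : y * f i = f i * y + z) (hz : ∀ j, z * f j = f j * z)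
    (hne : ∀ j, j ≠ i → y * f j = f j * y) (a b : Fin n → ℕ) (hi : b i = a i - 1)
    (hj : ∀ j, j ≠ i → b j = a j) :
    y * (List.ofFn fun j => f j ^ a j).prod = (List.ofFn fun j => f j ^ a j).prod * y
      + a i * (z * (List.ofFn fun j => f j ^ b j).prod) := by
  induction n with
  | zero => exact i.elim0
  | succ n ih =>
    simp only [List.ofFn_succ, List.prod_cons]
    cases i using Fin.cases with
    | zero =>
      have hc := commute_prod_ofFn_pow (fun j : Fin n => f j.succ)
        (fun j => hne _ (Fin.succ_ne_zero j)) (fun j => a j.succ)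
      rw [← mul_assoc, mul_pow_of_mul_eq h (hz 0), hi]
      simp only [fun j : Fin n => hj j.succ (Fin.succ_ne_zero j)]
      rw [add_mul, mul_assoc, hc.eq]
      simp only [mul_assoc]
    | succ i =>
      have h0 := hj 0 (Fin.succ_ne_zero i).symm
      have hy : y * f 0 ^ a 0 = f 0 ^ a 0 * y :=
        ((show Commute y (f 0) from hne 0 (Fin.succ_ne_zero i).symm).pow_right _).eq
      have hz0 : z * f 0 ^ a 0 = f 0 ^ a 0 * z := ((show Commute z (f 0) from hz 0).pow_right _).eq
      rw [← mul_assoc, hy, mul_assoc, ih (fun j => f j.succ) i h (fun _ => hz _)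
        (fun j hji => hne _ (fun h => hji (Fin.succ_injective _ h))) (fun j => a j.succ)
        (fun j => b j.succ) hi (fun j hji => hj _ (fun h => hji (Fin.succ_injective _ h))), h0,
        mul_add, ← mul_assoc z, hz0, ← mul_assoc (f 0 ^ a 0) (a i.succ : R), ← (Nat.cast_commute (a i.succ) (f 0 ^ a 0)).eq]
      simp only [mul_assoc]

end NormalOrdering

namespace Setting

variable {n N : ℕ} {K R : Type*} [Field K] [Ring R] [Algebra K R] (S : Setting n N K R)

/-- The normally ordered monomial `h^γ x^α ∂^β` of `R`. -/
def normalMon (d : Mon n) : R :=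
  S.Xg none ^ d none *
    ((List.ofFn fun i : Fin n => S.Xg (some (Sum.inl i)) ^ d (some (Sum.inl i))).prod *
     (List.ofFn fun i : Fin n => S.Xg (some (Sum.inr i)) ^ d (some (Sum.inr i))).prod)

lemma Psi_normalMon (d : Mon n) : S.Psi (S.normalMon d) = monomial d 1 := S.Psi_monomial d

lemma Xg_none_mul_normalMon (d : Mon n) :
    S.Xg none * S.normalMon d = S.normalMon (Finsupp.single none 1 + d) := by
  simp [normalMon, add_comm 1, pow_succ', mul_assoc]

lemma Xg_inl_mul_normalMon (i : Fin n) (d : Mon n) :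
    S.Xg (some (Sum.inl i)) * S.normalMon d =
      S.normalMon (Finsupp.single (some (Sum.inl i)) 1 + d) := by
  have hc : Commute (S.Xg (some (Sum.inl i))) (S.Xg none ^ d none) :=
    (show Commute _ _ from (S.h_comm (some (Sum.inl i))).symm).pow_right _
  have hx := mul_prod_ofFn_pow (fun j => S.Xg (some (Sum.inl j))) S.x_comm
    (fun j => d (some (Sum.inl j)))
    (fun j => (Finsupp.single (some (Sum.inl i)) 1 + d : Mon n) (some (Sum.inl j))) i
    (by simp [add_comm]) (fun j hj => by simp [Ne.symm hj])
  rw [normalMon, normalMon, ← hx, ← mul_assoc, hc.eq]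
  simp [mul_assoc]

lemma Xg_inr_mul_normalMon (i : Fin n) (d : Mon n) :
    S.Xg (some (Sum.inr i)) * S.normalMon d =
      S.normalMon (Finsupp.single (some (Sum.inr i)) 1 + d) +
        (d (some (Sum.inl i)) : K) • S.normalMon
          (Finsupp.single none 2 + (d - Finsupp.single (some (Sum.inl i)) 1)) := by
  have hh : ∀ v, Commute (S.Xg none) (S.Xg v) := S.h_comm
  have hc : Commute (S.Xg (some (Sum.inr i))) (S.Xg none ^ d none) := (hh _).symm.pow_right _
  have hd := mul_prod_ofFn_pow (fun j => S.Xg (some (Sum.inr j))) S.d_comm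
    (fun j => d (some (Sum.inr j)))
    (fun j => (Finsupp.single (some (Sum.inr i)) 1 + d : Mon n) (some (Sum.inr j))) i
    (by simp [add_comm]) (fun j hj => by simp [Ne.symm hj])
  have hx := mul_prod_ofFn_pow_of_mul_eq (fun j => S.Xg (some (Sum.inl j))) i (S.dx_h i)
    (fun j => ((hh _).pow_left 2).eq) (fun j hj => S.dx_comm i j hj.symm)
    (fun j => d (some (Sum.inl j)))
    (fun j => (Finsupp.single none 2 + (d - Finsupp.single (some (Sum.inl i)) 1) : Mon n)
      (some (Sum.inl j)))
    (by simp) (fun j hj => by simp [Ne.symm hj])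
  rw [normalMon, normalMon, normalMon, ← hd, ← mul_assoc, hc.eq, mul_assoc, ← mul_assoc _ _
    (List.prod _), hx, add_mul, mul_add]
  congr 1
  · simp [mul_assoc]
  · rw [Nat.cast_smul_eq_nsmul, nsmul_eq_mul, mul_assoc (d _ : R),
      (Nat.cast_commute (d (some (Sum.inl i))) (S.Xg none ^ d none)).symm.left_comm]
    simp [mul_assoc, add_comm 2, pow_add]

lemma eq_sum_normalMon (v : R) :
    v = ∑ d ∈ (S.Psi v).support, (S.Psi v).coeff d • S.normalMon d := by
  apply S.Psi.injective
  simp only [map_sum, map_smul, Psi_normalMon, smul_monomial, smul_eq_mul, mul_one]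
  exact (support_sum_monomial_coeff _).symm

/-- If left multiplication by `Xg u` acts on normally ordered monomials as the commutative one up
to terms of smaller degree or `w`-weight, it acts as the commutative one on leading monomials. -/
lemma isLM_Xg_mul_of_normalMon (u : Vars n) (q : Mon n → K) (s : Mon n → Mon n)
    (hu : ∀ d, S.Xg u * S.normalMon d =
      S.normalMon (Finsupp.single u 1 + d) + q d • S.normalMon (s d))
    (hs : ∀ d, q d ≠ 0 → mdeg (s d) = mdeg (Finsupp.single u 1 + d) ∧
      wdeg S.D.w (s d) < wdeg S.D.w (Finsupp.single u 1 + d))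
    {v : R} {d : Mon n} (h : IsLM S.D (S.Psi v) d) :
    IsLM S.D (S.Psi (S.Xg u * v)) (Finsupp.single u 1 + d) := by
  have hexp : S.Psi (S.Xg u * v) = X u * S.Psi v +
      ∑ e ∈ (S.Psi v).support, monomial (s e) ((S.Psi v).coeff e * q e) := by
    conv_lhs => rw [S.eq_sum_normalMon v]
    conv_rhs => enter [1, 2]; rw [← support_sum_monomial_coeff (S.Psi v)]
    simp only [Finset.mul_sum, ← Finset.sum_add_distrib, map_sum, mul_smul_comm, hu, map_add,
      map_smul, Psi_normalMon, smul_add, smul_monomial, smul_eq_mul, mul_one, X, monomial_mul,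
      one_mul]
  rw [hexp]
  refine h.X_mul_add u fun e he => ?_
  rw [mem_support_iff, coeff_sum] at he
  obtain ⟨e', he', hne⟩ := Finset.exists_ne_zero_of_sum_ne_zero he
  rw [coeff_monomial] at hne
  split_ifs at hne with hse
  · subst hse
    obtain ⟨h1, h2⟩ := hs e' (right_ne_zero_of_mul hne)
    by_cases hed : e' = d
    · subst hed
      exact Or.inr ⟨h1, h2⟩
    rw [mdeg_add] at h1 ⊢
    rw [wdeg_add] at h2 ⊢
    rcases h.2 e' he' hed with h | ⟨h3, h | ⟨h4, -⟩⟩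
    · exact Or.inl (by omega)
    · exact Or.inr ⟨by omega, by linarith⟩
    · exact Or.inr ⟨by omega, by linarith⟩
  · exact absurd rfl hne

lemma isLM_Xg_mul (u : Vars n) {v : R} {d : Mon n} (h : IsLM S.D (S.Psi v) d) :
    IsLM S.D (S.Psi (S.Xg u * v)) (Finsupp.single u 1 + d) := by
  match u with
  | none =>
    exact S.isLM_Xg_mul_of_normalMon none 0 id
      (fun d => by simp [Xg_none_mul_normalMon]) (fun d hd => absurd rfl hd) h
  | some (Sum.inl i) =>
    exact S.isLM_Xg_mul_of_normalMon _ 0 id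
      (fun d => by simp [Xg_inl_mul_normalMon]) (fun d hd => absurd rfl hd) h
  | some (Sum.inr i) =>
    refine S.isLM_Xg_mul_of_normalMon _ _ _ (S.Xg_inr_mul_normalMon i) (fun d hd => ?_) h
    have hd' : d (some (Sum.inl i)) ≠ 0 := fun h0 => hd (by simp [h0])
    have hle : Finsupp.single (some (Sum.inl i)) 1 ≤ d := by
      rw [Finsupp.single_le_iff]
      omega
    obtain ⟨e, rfl⟩ := exists_add_of_le hle
    have hw := S.D.w_nonneg i
    have hw' := S.D.w_big i i
    simp only [add_tsub_cancel_left, mdeg_add, wdeg_add]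
    constructor
    · simp [mdeg]
      omega
    · simp [wdeg, Finsupp.single_apply]
      linarith

lemma exists_isLM_mul (c : Mon n) : ∃ r : R, ∀ (v : R) (d : Mon n),
    IsLM S.D (S.Psi v) d → IsLM S.D (S.Psi (r * v)) (c + d) := by
  induction c using Finsupp.induction_linear with
  | zero => exact ⟨1, fun v d h => by simpa using h⟩
  | add c c' hc hc' =>
    obtain ⟨r, hr⟩ := hc
    obtain ⟨r', hr'⟩ := hc'
    exact ⟨r * r', fun v d h => by
      rw [mul_assoc, add_assoc]
      exact hr _ _ (hr' _ _ h)⟩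
  | single u k =>
    induction k with
    | zero => exact ⟨1, fun v d h => by simpa using h⟩
    | succ k ih =>
      obtain ⟨r, hr⟩ := ih
      refine ⟨S.Xg u * r, fun v d h => ?_⟩
      rw [mul_assoc, add_comm k, Finsupp.single_add, add_assoc]
      exact S.isLM_Xg_mul u (hr _ _ h)

lemma nu_add (a b : Fin N → R) : S.nu (a + b) = S.nu a + S.nu b := by
  simp [nu, add_mul, Finset.sum_add_distrib]

lemma nu_mul_left (c : R) (a : Fin N → R) : S.nu (fun i => c * a i) = c * S.nu a := by
  simp [nu, Finset.mul_sum, mul_assoc]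

/-- `ν` as a `K`-linear map. -/
def nuLin : (Fin N → R) →ₗ[K] R where
  toFun := S.nu
  map_add' := S.nu_add
  map_smul' c a := by simp [nu, Finset.smul_sum]

lemma IsSyzLM.mul_left {m : MMon n N} (h : S.IsSyzLM m) (c : Mon n) :
    S.IsSyzLM (c + m.1, m.2) := by
  obtain ⟨a, ha, -, htop, hLM⟩ := h
  obtain ⟨r, hr⟩ := S.exists_isLM_mul c
  have hLM' := hr _ _ hLM
  refine ⟨fun i => r * a i, by rw [nu_mul_left, ha, mul_zero], fun h0 => ?_,
    fun j hj => by simp [htop j hj], hLM'⟩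
  have := hLM'.1
  rw [show r * a m.2 = 0 from h0] at this
  simp at this

lemma exists_isSyzLM_le {v : Fin N → Poly n K} (hv : v ∈ S.LSyz) :
    ∀ (j : Fin N), ∀ e ∈ (v j).support, ∃ d, S.IsSyzLM (d, j) ∧ d ≤ e := by
  classical
  induction hv using Submodule.span_induction with
  | mem v hv =>
    obtain ⟨⟨d, i⟩, hm, rfl⟩ := hv
    intro j e he
    by_cases hij : j = i
    · subst hij
      simp only [msingle, Pi.single_eq_same] at he
      exact ⟨d, hm, (Finset.mem_singleton.mp (support_monomial_subset he)).ge⟩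
    · simp [msingle, hij] at he
  | zero => simp
  | add v w _ _ hv hw =>
    intro j e he
    rcases Finset.mem_union.mp (support_add he) with he | he
    · exact hv j e he
    · exact hw j e he
  | smul p v _ hv =>
    intro j e he
    obtain ⟨e₁, -, e₂, he₂, rfl⟩ := Finset.mem_add.mp (support_mul _ _ he)
    obtain ⟨d, hd, hle⟩ := hv j e₂ he₂
    exact ⟨d, hd, hle.trans le_add_self⟩

/-- Every module monomial in `LSyz` is the leading monomial of a syzygy. -/
lemma isSyzLM_of_inLSyz {m : MMon n N} (h : S.inLSyz m) : S.IsSyzLM m := by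
  obtain ⟨d, hd, hle⟩ := S.exists_isSyzLM_le h m.2 m.1 (by classical simp [msingle])
  obtain ⟨c, hc⟩ := exists_add_of_le hle
  have := hd.mul_left S c
  rwa [add_comm, ← hc] at this

/-- A module element can be modified by a syzygy supported on indices `≤ i` so that its `i`-th
component has no term in `LSyz`. -/
lemma exists_syz_sub_clean (g : Fin N → R) (i : Fin N) :
    ∃ a : Fin N → R, S.nu a = 0 ∧ (∀ j, i < j → a j = 0) ∧
      ∀ d ∈ (S.Psi ((g - a) i)).support, ¬ S.inLSyz (d, i) := by
  classical
  set k := (S.Psi (g i)).support.sup mdeg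
  have hfin : {d : Mon n | mdeg d ≤ k ∧ S.inLSyz (d, i)}.Finite :=
    (finite_setOf_mdeg_le k).subset fun d hd => hd.1
  set L := hfin.toFinset with hL
  have hLmem : ∀ d, d ∈ L ↔ mdeg d ≤ k ∧ S.inLSyz (d, i) := fun d => by simp [hL]
  have hsyz : ∀ m : L, S.IsSyzLM ((m : Mon n), i) := fun m =>
    S.isSyzLM_of_inLSyz ((hLmem m).mp m.2).2
  choose a ha0 _ hatop haLM using hsyz
  obtain ⟨c, hc⟩ := exists_sum_coeff_eq S.D L (fun m => S.Psi (a m i)) haLM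
    (fun m => (S.Psi (g i)).coeff m)
  refine ⟨∑ m, c m • a m, ?_, fun j hj => ?_, fun d hd hdL => ?_⟩
  · change S.nuLin _ = 0
    rw [map_sum]
    refine Finset.sum_eq_zero fun m _ => ?_
    rw [map_smul, show S.nuLin (a m) = 0 from ha0 m, smul_zero]
  · rw [Finset.sum_apply]
    exact Finset.sum_eq_zero fun m _ => by rw [Pi.smul_apply, hatop m j hj, smul_zero]
  · have hcoeff : (S.Psi ((g - ∑ m, c m • a m) i)).coeff d =
        (S.Psi (g i)).coeff d - ∑ m, c m * (S.Psi (a m i)).coeff d := by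
      simp [Finset.sum_apply, coeff_sum]
    rw [mem_support_iff, hcoeff] at hd
    by_cases hdk : mdeg d ≤ k
    · exact hd (sub_eq_zero.mpr (hc ⟨d, (hLmem d).mpr ⟨hdk, hdL⟩⟩).symm)
    · refine hd ?_
      have h1 : (S.Psi (g i)).coeff d = 0 := notMem_support_iff.mp fun h =>
        hdk (Finset.le_sup (f := mdeg) h)
      rw [h1, zero_sub, neg_eq_zero]
      refine Finset.sum_eq_zero fun m _ => ?_
      rw [notMem_support_iff.mp fun h => hdk (((haLM m).mdeg_le h).trans ((hLmem m).mp m.2).1),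
        mul_zero]

lemma exists_nu_eq_clean_ge (g : Fin N → R) {k : ℕ} (hk : k ≤ N) :
    ∃ g' : Fin N → R, S.nu g' = S.nu g ∧
      ∀ m : MMon n N, k ≤ m.2 → m.1 ∈ (S.Psi (g' m.2)).support → ¬ S.inLSyz m := by
  induction hk using Nat.decreasingInduction with
  | self => exact ⟨g, rfl, fun m hm => absurd m.2.isLt (not_lt.mpr hm)⟩
  | of_succ k hk ih =>
    obtain ⟨g', hg', hclean⟩ := ih
    obtain ⟨a, ha, htop, hai⟩ := S.exists_syz_sub_clean g' ⟨k, hk⟩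
    refine ⟨g' - a, ?_, fun ⟨d, j⟩ hj hd => ?_⟩
    · rw [← hg']
      change S.nuLin (g' - a) = S.nuLin g'
      rw [map_sub, show S.nuLin a = 0 from ha, sub_zero]
    · by_cases hjk : j = ⟨k, hk⟩
      · subst hjk
        exact hai d hd
      · have hlt : k < j := lt_of_le_of_ne hj fun h => hjk (Fin.ext h.symm)
        refine hclean (d, j) hlt ?_
        simpa [htop j hlt] using hd

end Setting

end TropF5

open TropF5 MvPolynomial

variable {n N : ℕ} [NeZero N] {K R : Type*} [Field K] [Ring R] [Algebra K R]

/-- Proposition `prop_simple`. Any `g ∈ R^N` with `ν(g) ≠ 0` can be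
carried to a clean module element `g'` with `ν(g') = ν(g)`. -/
theorem stmt2 (S : Setting n N K R) (g : Fin N → R) (hg : S.nu g ≠ 0) :
    ∃ g' : Fin N → R, S.Clean g' ∧ S.nu g' = S.nu g := by
  obtain ⟨g', hg', hclean⟩ := S.exists_nu_eq_clean_ge g (Nat.zero_le N)
  exact ⟨g', ⟨hg' ▸ hg, fun m => hclean m (Nat.zero_le _)⟩, hg'⟩

end
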